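/- arXiv:1311.0355 — 3 statements merged into one kernel-verified Lean document; each statement's English description precedes it below -/
import Mathlib

section
/- Suppose the weight function w is symmetric and x is a solution of the opinion dynamics. Then there exists a finite Borel measure μ_∞ supported on [0,1] such that the measures μ_t converge in distribution to μ_∞ as t → ∞. -/
open MeasureTheory Filter Set Topology

/-- The interaction field at time `t` for agent `α`:
`∫_0^1 w(t,α,β,x_t(α),x_t(β)) · (x_t(β) − x_t(α)) dβ`. -/
noncomputable def interactionField (w : ℝ → ℝ → ℝ → ℝ → ℝ → ℝ) (x : ℝ → ℝ → ℝ)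
    (t α : ℝ) : ℝ :=
  ∫ β in (0:ℝ)..1, w t α β (x t α) (x t β) * (x t β - x t α)

/-- `f` is absolutely continuous on the compact interval `[a,b]`. -/
def AbsolutelyContinuousOn (f : ℝ → ℝ) (a b : ℝ) : Prop :=
  ∀ ε > 0, ∃ δ > 0, ∀ n : ℕ, ∀ c d : Fin n → ℝ,
    (∀ i, a ≤ c i ∧ c i ≤ d i ∧ d i ≤ b) →
    (Pairwise fun i j => Set.Ioo (c i) (d i) ∩ Set.Ioo (c j) (d j) = ∅) →
    (∑ i, (d i - c i)) < δ → (∑ i, |f (d i) - f (c i)|) < ε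

/-- `w` is an admissible weight function: jointly Borel measurable, nonnegative and
bounded by `W` on the domain `[0,∞) × [0,1] × [0,1] × ℝ × ℝ`. -/
structure IsWeight (W : ℝ) (w : ℝ → ℝ → ℝ → ℝ → ℝ → ℝ) : Prop where
  measurable : Measurable fun p : ℝ × ℝ × ℝ × ℝ × ℝ =>
    w p.1 p.2.1 p.2.2.1 p.2.2.2.1 p.2.2.2.2
  nonneg : ∀ t, 0 ≤ t → ∀ α ∈ Icc (0:ℝ) 1, ∀ β ∈ Icc (0:ℝ) 1, ∀ a b : ℝ,
    0 ≤ w t α β a b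
  le_bound : ∀ t, 0 ≤ t → ∀ α ∈ Icc (0:ℝ) 1, ∀ β ∈ Icc (0:ℝ) 1, ∀ a b : ℝ,
    w t α β a b ≤ W

/-- `x` is a solution of the opinion dynamics with weight function `w`:
measurable in the agent, absolutely continuous in time on compact intervals,
with initial opinions in `[0,1]`, locally bounded, and for each agent satisfying
the ODE `(d/dt) x_t(α) = ∫_0^1 w(t,α,β,x_t(α),x_t(β))·(x_t(β) − x_t(α)) dβ`
for almost every `t ≥ 0`. -/
structure IsSolution (w : ℝ → ℝ → ℝ → ℝ → ℝ → ℝ) (x : ℝ → ℝ → ℝ) : Prop where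
  meas : ∀ t, 0 ≤ t → Measurable (x t)
  absCont : ∀ α ∈ Icc (0:ℝ) 1, ∀ T, 0 ≤ T → AbsolutelyContinuousOn (fun t => x t α) 0 T
  init_mem : ∀ α ∈ Icc (0:ℝ) 1, x 0 α ∈ Icc (0:ℝ) 1
  locBdd : ∀ T, 0 ≤ T → ∃ M : ℝ, ∀ α ∈ Icc (0:ℝ) 1, ∀ t ∈ Icc (0:ℝ) T, |x t α| ≤ M
  ode : ∀ α ∈ Icc (0:ℝ) 1, ∀ᵐ t ∂(volume.restrict (Ici (0:ℝ))),
    HasDerivAt (fun s => x s α) (interactionField w x t α) t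

/-- The weight function is symmetric. -/
def SymmetricWeight (w : ℝ → ℝ → ℝ → ℝ → ℝ → ℝ) : Prop :=
  ∀ t α β a b, w t α β a b = w t β α b a

/-- `w ∈ Γ(r,Δ)`: the weight is at least `Δ` whenever the two opinions are within `r`. -/
def InGamma (r Δ : ℝ) (w : ℝ → ℝ → ℝ → ℝ → ℝ → ℝ) : Prop :=
  ∀ t, 0 ≤ t → ∀ α ∈ Icc (0:ℝ) 1, ∀ β ∈ Icc (0:ℝ) 1, ∀ a b : ℝ,
    |a - b| ≤ r → Δ ≤ w t α β a b

/-- The opinion distribution `μ_t`: pushforward of Lebesgue measure on `[0,1]` by `x_t`. -/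
noncomputable def opinionMeasure (x : ℝ → ℝ → ℝ) (t : ℝ) : Measure ℝ :=
  (volume.restrict (Icc (0:ℝ) 1)).map (x t)

/-- The order of the opinions is preserved: if agent `β`'s opinion is strictly above
agent `α`'s at some time, it is strictly above at every time. -/
def OrderPreserved (x : ℝ → ℝ → ℝ) : Prop :=
  ∀ α ∈ Icc (0:ℝ) 1, ∀ β ∈ Icc (0:ℝ) 1, ∀ s, 0 ≤ s → ∀ t, 0 ≤ t →
    x t α < x t β → x s α < x s β

theorem AbsolutelyContinuousOn.comp_of_abs_sub_le {f φ : ℝ → ℝ} {a b K : ℝ} {A : Set ℝ}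
    (hf : AbsolutelyContinuousOn f a b) (hA : ∀ t ∈ Icc a b, f t ∈ A)
    (hφ : ∀ u ∈ A, ∀ v ∈ A, |φ v - φ u| ≤ K * |v - u|) :
    AbsolutelyContinuousOn (fun t => φ (f t)) a b := by
  intro ε hε
  obtain ⟨δ, hδ, h⟩ := hf (ε / (|K| + 1)) (by positivity)
  refine ⟨δ, hδ, fun n c d hcd hdisj hsum => ?_⟩
  have h1 := h n c d hcd hdisj hsum
  calc ∑ i, |φ (f (d i)) - φ (f (c i))| ≤ ∑ i, (|K| + 1) * |f (d i) - f (c i)| := by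
        refine Finset.sum_le_sum fun i _ => ?_
        obtain ⟨h2, h3, h4⟩ := hcd i
        refine (hφ _ (hA _ ⟨h2, h3.trans h4⟩) _ (hA _ ⟨h2.trans h3, h4⟩)).trans ?_
        gcongr
        linarith [le_abs_self K]
    _ = (|K| + 1) * ∑ i, |f (d i) - f (c i)| := (Finset.mul_sum _ _ _).symm
    _ < (|K| + 1) * (ε / (|K| + 1)) := by gcongr
    _ = ε := by field_simp

theorem AbsolutelyContinuousOn.absolutelyContinuousOnInterval {f : ℝ → ℝ} {a b c d : ℝ}
    (hf : AbsolutelyContinuousOn f a b) (hac : a ≤ c) (hcd : c ≤ d) (hdb : d ≤ b) :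
    AbsolutelyContinuousOnInterval f c d := by
  rw [absolutelyContinuousOnInterval_iff]
  intro ε hε
  obtain ⟨δ, hδ, h⟩ := hf ε hε
  refine ⟨δ, hδ, fun E hE hsum => ?_⟩
  obtain ⟨hE1, hE2⟩ := hE
  have key := h E.1 (fun i => min (E.2 i).1 (E.2 i).2) (fun i => max (E.2 i).1 (E.2 i).2)
    ?_ ?_ ?_
  · rw [Finset.sum_range]
    refine lt_of_eq_of_lt (Finset.sum_congr rfl fun i _ => ?_) key
    rcases le_total (E.2 i).1 (E.2 i).2 with h1 | h1
    · simp only [max_eq_right h1, min_eq_left h1]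
      rw [dist_comm, Real.dist_eq]
    · simp only [max_eq_left h1, min_eq_right h1]
      rw [Real.dist_eq]
  · intro i
    obtain ⟨h1, h2⟩ := hE1 i (Finset.mem_range.2 i.2)
    rw [uIcc_of_le hcd] at h1 h2
    exact ⟨hac.trans (le_min h1.1 h2.1), min_le_max, (max_le h1.2 h2.2).trans hdb⟩
  · intro i j hij
    have := hE2 (Finset.mem_coe.2 (Finset.mem_range.2 i.2))
      (Finset.mem_coe.2 (Finset.mem_range.2 j.2)) (fun h => hij (Fin.ext h))
    exact ((this.mono Ioo_subset_Ioc_self Ioo_subset_Ioc_self)).inter_eq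
  · rw [Finset.sum_range] at hsum
    refine lt_of_eq_of_lt (Finset.sum_congr rfl fun i _ => ?_) hsum
    rw [Real.dist_eq, max_sub_min_eq_abs']

theorem abs_sub_le_of_abs_deriv_le {φ g : ℝ → ℝ} (hφ : ∀ u, HasDerivAt φ (g u) u) {M K : ℝ}
    (hK : ∀ u ∈ Icc (-M) M, |g u| ≤ K) :
    ∀ u ∈ Icc (-M) M, ∀ v ∈ Icc (-M) M, |φ v - φ u| ≤ K * |v - u| := fun _ hu _ hv =>
  (convex_Icc (-M) M).norm_image_sub_le_of_norm_hasDerivWithin_le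
    (fun z _ => (hφ z).hasDerivWithinAt) hK hu hv

theorem Continuous.exists_abs_le_on_Icc {g : ℝ → ℝ} (hg : Continuous g) (M : ℝ) :
    ∃ K, ∀ u ∈ Icc (-M) M, |g u| ≤ K :=
  isCompact_Icc.exists_bound_of_continuousOn hg.continuousOn

/-- The chain rule in integrated form along an absolutely continuous path. -/
theorem AbsolutelyContinuousOn.integral_deriv_comp_eq_sub {f v φ g : ℝ → ℝ} {a b : ℝ}
    (hf : AbsolutelyContinuousOn f 0 b)
    (hfv : ∀ᵐ t ∂(volume.restrict (Ici (0:ℝ))), HasDerivAt f (v t) t)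
    (hφ : ∀ u, HasDerivAt φ (g u) u) (hg : Continuous g) (ha : 0 ≤ a) (hab : a ≤ b) :
    ∫ t in a..b, g (f t) * v t = φ (f b) - φ (f a) := by
  have hfc : ContinuousOn f (Icc 0 b) := by
    simpa [uIcc_of_le (ha.trans hab)] using
      (hf.absolutelyContinuousOnInterval le_rfl (ha.trans hab) le_rfl).continuousOn
  obtain ⟨M, hM⟩ := isCompact_Icc.exists_bound_of_continuousOn hfc
  obtain ⟨K, hK⟩ := hg.exists_abs_le_on_Icc M
  have hac := (hf.comp_of_abs_sub_le (fun t ht => abs_le.1 (hM t ht))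
    (abs_sub_le_of_abs_deriv_le hφ hK)).absolutelyContinuousOnInterval ha hab le_rfl
  rw [← hac.integral_deriv_eq_sub]
  refine intervalIntegral.integral_congr_ae ?_
  rw [ae_restrict_iff' measurableSet_Ici] at hfv
  filter_upwards [hfv] with t ht htab
  rw [uIoc_of_le hab] at htab
  exact (((hφ (f t)).comp t (ht (ha.trans htab.1.le))).deriv).symm

/-- A symmetric nonnegative kernel acting on differences dissipates against monotone functions. -/
theorem integral_mul_integral_symm_nonpos {Ω : Type*} [MeasurableSpace Ω] {ν : Measure Ω}
    [IsFiniteMeasure ν] {y : Ω → ℝ} {k : Ω → Ω → ℝ} {g : ℝ → ℝ} {A : Set ℝ} {M W : ℝ}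
    (hy : Measurable y) (hk : Measurable (Function.uncurry k)) (hg : Continuous g)
    (hsymm : ∀ α β, k α β = k β α) (hk0 : ∀ᵐ p ∂(ν.prod ν), 0 ≤ k p.1 p.2)
    (hkW : ∀ᵐ p ∂(ν.prod ν), k p.1 p.2 ≤ W) (hM : ∀ᵐ α ∂ν, |y α| ≤ M)
    (hA : ∀ᵐ α ∂ν, y α ∈ A) (hgA : MonotoneOn g A) :
    ∫ α, g (y α) * ∫ β, k α β * (y β - y α) ∂ν ∂ν ≤ 0 := by
  obtain ⟨K, hK⟩ := hg.exists_abs_le_on_Icc M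
  set G : Ω × Ω → ℝ := fun p => g (y p.1) * (k p.1 p.2 * (y p.2 - y p.1)) with hG
  have hk' : Measurable fun p : Ω × Ω => k p.1 p.2 := hk
  have hGm : Measurable G := by
    have := hg.measurable
    fun_prop
  have fstq {P : Ω → Prop} (h : ∀ᵐ α ∂ν, P α) : ∀ᵐ p ∂(ν.prod ν), P p.1 :=
    Measure.quasiMeasurePreserving_fst.ae h
  have sndq {P : Ω → Prop} (h : ∀ᵐ α ∂ν, P α) : ∀ᵐ p ∂(ν.prod ν), P p.2 :=
    Measure.quasiMeasurePreserving_snd.ae h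
  have hGi : Integrable G (ν.prod ν) := by
    refine Integrable.of_bound hGm.aestronglyMeasurable (K * (W * (M + M))) ?_
    filter_upwards [hk0, hkW, fstq hM, sndq hM] with p h0 hW h1 h2
    have h3 : |g (y p.1)| ≤ K := hK _ (abs_le.1 h1)
    rw [Real.norm_eq_abs, hG]
    simp only [abs_mul, abs_of_nonneg h0]
    have h4 : |y p.2 - y p.1| ≤ M + M := (abs_sub _ _).trans (add_le_add h2 h1)
    have hK0 := (abs_nonneg _).trans h3
    have hW0 := h0.trans hW
    gcongr
  have e1 : ∫ α, g (y α) * ∫ β, k α β * (y β - y α) ∂ν ∂ν = ∫ p, G p ∂(ν.prod ν) := by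
    rw [integral_prod _ hGi]
    simp only [hG, integral_const_mul]
  have e2 : ∫ p, G p.swap ∂(ν.prod ν) = ∫ p, G p ∂(ν.prod ν) := integral_prod_swap G
  have e3 : ∫ p, (G p + G p.swap) ∂(ν.prod ν) ≤ 0 := by
    refine integral_nonpos_of_ae ?_
    filter_upwards [hk0, fstq hA, sndq hA] with p h0 h1 h2
    have h3 : 0 ≤ (g (y p.2) - g (y p.1)) * (y p.2 - y p.1) := by
      rcases le_total (y p.1) (y p.2) with h | h
      · exact mul_nonneg (sub_nonneg.2 (hgA h1 h2 h)) (sub_nonneg.2 h)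
      · exact mul_nonneg_of_nonpos_of_nonpos (sub_nonpos.2 (hgA h2 h1 h)) (sub_nonpos.2 h)
    have h4 := mul_nonneg h0 h3
    simp only [hG, Prod.fst_swap, Prod.snd_swap, hsymm p.2 p.1, Pi.zero_apply]
    linarith
  have e4 : ∫ p, (G p + G p.swap) ∂(ν.prod ν) =
      ∫ p, G p ∂(ν.prod ν) + ∫ p, G p.swap ∂(ν.prod ν) :=
    integral_add hGi hGi.swap
  rw [e4, e2] at e3
  rw [e1]
  linarith

/-- On the unit interval, convergence of all moments implies weak convergence. -/
theorem exists_tendsto_of_tendsto_moments {ι : Type*} {F : Filter ι} [F.NeBot]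
    (μ : ι → ProbabilityMeasure (Icc (0:ℝ) 1))
    (h : ∀ n : ℕ, ∃ l, Tendsto (fun i => ∫ u, (u:ℝ) ^ n ∂(μ i : Measure (Icc (0:ℝ) 1))) F (𝓝 l)) :
    ∃ P, Tendsto μ F (𝓝 P) := by
  obtain ⟨P, hP⟩ := exists_clusterPt_of_compactSpace (map μ F)
  have hint (Q : ProbabilityMeasure (Icc (0:ℝ) 1)) {f : Icc (0:ℝ) 1 → ℝ} (hf : Continuous f) :
      Integrable f (Q : Measure (Icc (0:ℝ) 1)) :=
    hf.integrable_of_hasCompactSupport (HasCompactSupport.of_compactSpace f)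
  have hpow (n : ℕ) : Tendsto (fun i => ∫ u, (u:ℝ) ^ n ∂(μ i : Measure (Icc (0:ℝ) 1))) F
      (𝓝 (∫ u, (u:ℝ) ^ n ∂(P : Measure (Icc (0:ℝ) 1)))) := by
    obtain ⟨l, hl⟩ := h n
    have hc := ProbabilityMeasure.continuous_integral_continuousMap
      (⟨fun u => (u:ℝ) ^ n, by fun_prop⟩ : C(Icc (0:ℝ) 1, ℝ))
    have hcl := hP.map hc.continuousAt tendsto_map
    have hne := ClusterPt.mono hcl (show _ ≤ 𝓝 l from hl)
    exact (eq_of_nhds_neBot hne : ∫ u, (u:ℝ) ^ n ∂(P : Measure (Icc (0:ℝ) 1)) = l) ▸ hl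
  have hpoly (p : Polynomial ℝ) :
      Tendsto (fun i => ∫ u, p.eval (u:ℝ) ∂(μ i : Measure (Icc (0:ℝ) 1))) F
        (𝓝 (∫ u, p.eval (u:ℝ) ∂(P : Measure (Icc (0:ℝ) 1)))) := by
    have e (Q : ProbabilityMeasure (Icc (0:ℝ) 1)) :
        ∫ u, p.eval (u:ℝ) ∂(Q : Measure (Icc (0:ℝ) 1)) =
          ∑ n ∈ Finset.range (p.natDegree + 1),
            p.coeff n * ∫ u, (u:ℝ) ^ n ∂(Q : Measure (Icc (0:ℝ) 1)) := by
      simp only [Polynomial.eval_eq_sum_range]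
      rw [integral_finsetSum _ fun n _ => hint Q (by fun_prop)]
      simp only [integral_const_mul]
    simp only [e]
    exact tendsto_finsetSum _ fun n _ => (hpow n).const_mul _
  refine ⟨P, ProbabilityMeasure.tendsto_iff_forall_integral_tendsto.2 fun f => ?_⟩
  rw [Metric.tendsto_nhds]
  intro ε hε
  obtain ⟨p, hp⟩ := exists_polynomial_near_continuousMap 0 1 f.toContinuousMap (ε / 4)
    (by positivity)
  rw [ContinuousMap.norm_lt_iff _ (by positivity)] at hp
  have hclose (Q : ProbabilityMeasure (Icc (0:ℝ) 1)) :
      |∫ u, p.eval (u:ℝ) ∂(Q : Measure (Icc (0:ℝ) 1)) - ∫ u, f u ∂(Q : Measure (Icc (0:ℝ) 1))|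
        ≤ ε / 4 := by
    rw [← integral_sub (hint Q (by fun_prop)) (hint Q f.continuous)]
    refine (norm_integral_le_of_norm_le_const (ae_of_all _ fun u => (hp u).le)).trans ?_
    simp
  filter_upwards [Metric.tendsto_nhds.1 (hpoly p) (ε / 4) (by positivity)] with i hi
  rw [Real.dist_eq] at hi ⊢
  have h1 := abs_le.1 (hclose (μ i))
  have h2 := abs_le.1 (hclose P)
  have h3 := abs_lt.1 hi
  exact abs_lt.2 ⟨by linarith, by linarith⟩

theorem hasDerivAt_max_zero_sq (u : ℝ) :
    HasDerivAt (fun v : ℝ => max v 0 ^ 2) (2 * max u 0) u := by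
  rcases lt_trichotomy u 0 with h | h | h
  · rw [max_eq_right h.le, mul_zero]
    refine (hasDerivAt_const u (0:ℝ)).congr_of_eventuallyEq ?_
    filter_upwards [Iio_mem_nhds h] with v hv
    simp [max_eq_right (le_of_lt (mem_Iio.1 hv))]
  · subst h
    have h1 : HasDerivWithinAt (fun v : ℝ => max v 0 ^ 2) (2 * max 0 0) (Iic 0) 0 := by
      rw [max_self, mul_zero]
      refine (hasDerivWithinAt_const (0:ℝ) (Iic 0) (0:ℝ)).congr (fun v hv => ?_) (by simp)
      simp [max_eq_right (mem_Iic.1 hv)]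
    have h2 : HasDerivWithinAt (fun v : ℝ => max v 0 ^ 2) (2 * max 0 0) (Ici 0) 0 := by
      have := (hasDerivAt_pow 2 (0:ℝ)).hasDerivWithinAt (s := Ici 0)
      simp only [Nat.cast_ofNat] at this
      refine HasDerivWithinAt.congr (by simpa using this) (fun v hv => ?_) (by simp)
      simp [max_eq_left (mem_Ici.1 hv)]
    simpa using (h1.union h2).hasDerivAt (by simp)
  · rw [max_eq_left h.le]
    have := hasDerivAt_pow 2 u
    refine HasDerivAt.congr_of_eventuallyEq (by simpa using this) ?_
    filter_upwards [Ioi_mem_nhds h] with v hv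
    simp [max_eq_left (le_of_lt (mem_Ioi.1 hv))]

/-- The opinions, frozen before time `0` and set to `0` outside the set of agents; unlike `x`
itself, this function is jointly measurable on the whole plane. -/
noncomputable def truncatedOpinion (x : ℝ → ℝ → ℝ) (t : ℝ) : ℝ → ℝ :=
  (Icc (0:ℝ) 1).indicator (x (max t 0))

theorem truncatedOpinion_eq (x : ℝ → ℝ → ℝ) {t α : ℝ} (ht : 0 ≤ t) (hα : α ∈ Icc (0:ℝ) 1) :
    truncatedOpinion x t α = x t α := by
  simp [truncatedOpinion, indicator_of_mem hα, max_eq_left ht]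

theorem truncatedOpinion_max_zero (x : ℝ → ℝ → ℝ) (t : ℝ) :
    truncatedOpinion x (max t 0) = truncatedOpinion x t := by
  simp [truncatedOpinion]

namespace IsSolution

variable {w : ℝ → ℝ → ℝ → ℝ → ℝ → ℝ} {x : ℝ → ℝ → ℝ} {W : ℝ}

theorem continuous_time (hx : IsSolution w x) (α : ℝ) :
    Continuous fun t => truncatedOpinion x t α := by
  by_cases hα : α ∈ Icc (0:ℝ) 1
  · have h1 : ContinuousOn (fun t => x t α) (Ici 0) := by
      intro t ht
      have h2 : ContinuousOn (fun t => x t α) (Icc 0 (t + 1)) := by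
        have ht' : (0:ℝ) ≤ t + 1 := by linarith [mem_Ici.1 ht]
        simpa [uIcc_of_le ht'] using ((hx.absCont α hα (t + 1) ht').absolutelyContinuousOnInterval
          le_rfl ht' le_rfl).continuousOn
      refine (h2 t ⟨ht, by linarith⟩).mono_of_mem_nhdsWithin ?_
      rw [← Ici_inter_Iic]
      exact inter_mem_nhdsWithin _ (Iic_mem_nhds (by linarith))
    simp only [truncatedOpinion, indicator_of_mem hα]
    exact h1.comp_continuous (by fun_prop) fun t => le_max_right t 0
  · simpa [truncatedOpinion, indicator_of_notMem hα] using continuous_const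

theorem measurable_truncatedOpinion (hx : IsSolution w x) (t : ℝ) :
    Measurable (truncatedOpinion x t) :=
  (hx.meas _ (le_max_right t 0)).indicator measurableSet_Icc

theorem measurable_uncurry (hx : IsSolution w x) :
    Measurable (Function.uncurry (truncatedOpinion x)) :=
  measurable_uncurry_of_continuous_of_measurable hx.continuous_time hx.measurable_truncatedOpinion

theorem exists_bound (hx : IsSolution w x) {T : ℝ} (hT : 0 ≤ T) :
    ∃ M, ∀ t ≤ T, ∀ α, |truncatedOpinion x t α| ≤ M := by
  obtain ⟨M, hM⟩ := hx.locBdd T hT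
  have hM0 : 0 ≤ M := (abs_nonneg _).trans (hM 0 (by simp) 0 ⟨le_rfl, hT⟩)
  refine ⟨M, fun t ht α => ?_⟩
  by_cases hα : α ∈ Icc (0:ℝ) 1
  · rw [truncatedOpinion, indicator_of_mem hα]
    exact hM α hα _ ⟨le_max_right t 0, max_le ht hT⟩
  · simpa [truncatedOpinion, indicator_of_notMem hα] using hM0

theorem integrable_comp (hx : IsSolution w x) {φ : ℝ → ℝ} (hφ : Continuous φ) (t : ℝ) :
    Integrable (fun α => φ (truncatedOpinion x t α)) (volume.restrict (Icc (0:ℝ) 1)) := by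
  obtain ⟨M, hM⟩ := hx.exists_bound (le_max_right t 0)
  obtain ⟨K, hK⟩ := hφ.exists_abs_le_on_Icc M
  exact Integrable.of_bound
    (hφ.measurable.comp (hx.measurable_truncatedOpinion t)).aestronglyMeasurable K (ae_of_all _ fun α => hK _ (abs_le.1 (hM t (le_max_left t 0) α)))

/-- Integrals of the opinions against a function with monotone derivative decrease. -/
theorem integral_comp_le (hx : IsSolution w x) (hw : IsWeight W w) (hsym : SymmetricWeight w)
    {φ g : ℝ → ℝ} {A : Set ℝ} (hφ : ∀ u, HasDerivAt φ (g u) u) (hg : Continuous g)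
    (hgA : MonotoneOn g A) {S T : ℝ} (hS : 0 ≤ S) (hST : S ≤ T)
    (hA : ∀ t, 0 ≤ t → ∀ᵐ α ∂(volume.restrict (Icc (0:ℝ) 1)), truncatedOpinion x t α ∈ A) :
    ∫ α in Icc (0:ℝ) 1, φ (truncatedOpinion x T α) ≤
      ∫ α in Icc (0:ℝ) 1, φ (truncatedOpinion x S α) := by
  set y := truncatedOpinion x with hy
  set ν := volume.restrict (Icc (0:ℝ) 1) with hν
  have hνI : ∀ᵐ α ∂ν, α ∈ Icc (0:ℝ) 1 := ae_restrict_mem measurableSet_Icc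
  have hT : 0 ≤ T := hS.trans hST
  obtain ⟨M, hM⟩ := hx.exists_bound hT
  obtain ⟨K, hK⟩ := hg.exists_abs_le_on_Icc M
  have hgK (t : ℝ) (ht : t ≤ T) (α : ℝ) : |g (y t α)| ≤ K := hK _ (abs_le.1 (hM t ht α))
  have hK0 : 0 ≤ K := (abs_nonneg _).trans (hgK T le_rfl 0)
  have hym : Measurable fun p : ℝ × ℝ => y p.1 p.2 := hx.measurable_uncurry
  have hwm := hw.measurable
  set k : ℝ → ℝ → ℝ → ℝ := fun t α β => w t α β (y t α) (y t β) with hk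
  have hkm : Measurable fun p : (ℝ × ℝ) × ℝ => k p.1.1 p.1.2 p.2 := by
    have h1 : Measurable fun p : (ℝ × ℝ) × ℝ => y p.1.1 p.1.2 := by fun_prop
    have h2 : Measurable fun p : (ℝ × ℝ) × ℝ => y p.1.1 p.2 :=
      hym.comp (by fun_prop : Measurable fun p : (ℝ × ℝ) × ℝ => (p.1.1, p.2))
    exact hwm.comp (by fun_prop : Measurable fun p : (ℝ × ℝ) × ℝ =>
      (p.1.1, p.1.2, p.2, y p.1.1 p.1.2, y p.1.1 p.2))
  set V : ℝ → ℝ → ℝ := fun t α => ∫ β, k t α β * (y t β - y t α) ∂ν with hV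
  have hVm : Measurable fun p : ℝ × ℝ => V p.1 p.2 := by
    have h1 : Measurable fun p : (ℝ × ℝ) × ℝ => y p.1.1 p.1.2 := by fun_prop
    have h2 : Measurable fun p : (ℝ × ℝ) × ℝ => y p.1.1 p.2 :=
      hym.comp (by fun_prop : Measurable fun p : (ℝ × ℝ) × ℝ => (p.1.1, p.2))
    have h3 : Measurable fun p : (ℝ × ℝ) × ℝ =>
      k p.1.1 p.1.2 p.2 * (y p.1.1 p.2 - y p.1.1 p.1.2) := by fun_prop
    exact (h3.stronglyMeasurable.integral_prod_right (ν := ν)).measurable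
  have hVeq (t : ℝ) (ht : 0 ≤ t) (α : ℝ) (hα : α ∈ Icc (0:ℝ) 1) :
      V t α = interactionField w x t α := by
    rw [hV, interactionField, intervalIntegral.integral_of_le zero_le_one,
      ← integral_Icc_eq_integral_Ioc]
    refine setIntegral_congr_fun measurableSet_Icc fun β hβ => ?_
    simp only [hk, hy, truncatedOpinion_eq x ht hα, truncatedOpinion_eq x ht hβ]
  have hVb (t : ℝ) (ht : 0 ≤ t) (htT : t ≤ T) (α : ℝ) (hα : α ∈ Icc (0:ℝ) 1) :
      |V t α| ≤ W * (M + M) := by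
    have : ‖∫ β, k t α β * (y t β - y t α) ∂ν‖ ≤ W * (M + M) * ν.real univ := by
      refine norm_integral_le_of_norm_le_const ?_
      filter_upwards [hνI] with β hβ
      have h0 := hw.nonneg t ht α hα β hβ (y t α) (y t β)
      have hW := hw.le_bound t ht α hα β hβ (y t α) (y t β)
      have h4 : |y t β - y t α| ≤ M + M :=
        (abs_sub _ _).trans (add_le_add (hM t htT β) (hM t htT α))
      have hW0 := h0.trans hW
      rw [Real.norm_eq_abs, abs_mul, abs_of_nonneg h0]
      gcongr
    simpa [hν] using this
  have hftc (α : ℝ) (hα : α ∈ Icc (0:ℝ) 1) :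
      φ (y T α) - φ (y S α) = ∫ t in Ioc S T, g (y t α) * V t α := by
    rw [hy, truncatedOpinion_eq x hT hα, truncatedOpinion_eq x hS hα,
      ← (hx.absCont α hα T hT).integral_deriv_comp_eq_sub (hx.ode α hα) hφ hg hS hST,
      intervalIntegral.integral_of_le hST]
    refine setIntegral_congr_fun measurableSet_Ioc fun t ht => ?_
    have ht0 : 0 ≤ t := hS.trans ht.1.le
    simp only [hVeq t ht0 α hα, truncatedOpinion_eq x ht0 hα]
  have hdiss (t : ℝ) (ht : 0 ≤ t) (htT : t ≤ T) : ∫ α, g (y t α) * V t α ∂ν ≤ 0 := by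
    have hp : ∀ᵐ p ∂(ν.prod ν), p.1 ∈ Icc (0:ℝ) 1 ∧ p.2 ∈ Icc (0:ℝ) 1 :=
      (Measure.quasiMeasurePreserving_fst.ae hνI).and (Measure.quasiMeasurePreserving_snd.ae hνI)
    refine integral_mul_integral_symm_nonpos (W := W) (hx.measurable_truncatedOpinion t)
      (hkm.comp (by fun_prop : Measurable fun p : ℝ × ℝ => ((t, p.1), p.2))) hg
      (fun α β => hsym _ _ _ _ _) ?_ ?_ (ae_of_all _ (hM t htT)) (hA t ht) hgA
    · filter_upwards [hp] with p hp using hw.nonneg t ht _ hp.1 _ hp.2 _ _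
    · filter_upwards [hp] with p hp using hw.le_bound t ht _ hp.1 _ hp.2 _ _
  have hint : Integrable (Function.uncurry fun α t => g (y t α) * V t α)
      (ν.prod (volume.restrict (Ioc S T))) := by
    have hm : Measurable fun p : ℝ × ℝ => g (y p.2 p.1) * V p.2 p.1 := by
      have h1 : Measurable fun p : ℝ × ℝ => y p.2 p.1 := hym.comp measurable_swap
      have h2 : Measurable fun p : ℝ × ℝ => V p.2 p.1 := hVm.comp measurable_swap
      exact (hg.measurable.comp h1).mul h2
    refine Integrable.of_bound hm.aestronglyMeasurable (K * (W * (M + M))) ?_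
    filter_upwards [Measure.quasiMeasurePreserving_fst.ae hνI,
      Measure.quasiMeasurePreserving_snd.ae
        (ae_restrict_mem (μ := (volume : Measure ℝ)) (measurableSet_Ioc (a := S) (b := T)))]
      with p h1 h2
    simp only [Function.uncurry, Real.norm_eq_abs, abs_mul]
    exact mul_le_mul (hgK _ h2.2 _) (hVb _ (hS.trans h2.1.le) h2.2 _ h1) (abs_nonneg _) hK0
  have hφc : Continuous φ := continuous_iff_continuousAt.2 fun u => (hφ u).continuousAt
  rw [← sub_nonpos, ← integral_sub (hx.integrable_comp hφc T) (hx.integrable_comp hφc S),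
    setIntegral_congr_fun measurableSet_Icc hftc, integral_integral_swap hint]
  exact setIntegral_nonpos measurableSet_Ioc fun t ht => hdiss t (hS.trans ht.1.le) ht.2

/-- Almost every opinion stays in the unit interval. -/
theorem ae_mem_Icc (hx : IsSolution w x) (hw : IsWeight W w) (hsym : SymmetricWeight w) {t : ℝ}
    (ht : 0 ≤ t) :
    ∀ᵐ α ∂(volume.restrict (Icc (0:ℝ) 1)), truncatedOpinion x t α ∈ Icc (0:ℝ) 1 := by
  set φ : ℝ → ℝ := fun u => max (u - 1) 0 ^ 2 + max (-u) 0 ^ 2 with hφ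
  set g : ℝ → ℝ := fun u => 2 * max (u - 1) 0 - 2 * max (-u) 0 with hg
  have hd (u : ℝ) : HasDerivAt φ (g u) u := by
    have h1 := (hasDerivAt_max_zero_sq (u - 1)).comp u ((hasDerivAt_id u).sub_const 1)
    have h2 := (hasDerivAt_max_zero_sq (-u)).comp u (hasDerivAt_id u).neg
    exact (h1.add h2).congr_deriv (by dsimp only [g]; ring)
  have hmono : Monotone g := fun a b hab => by
    dsimp only [g]
    gcongr
  have h := hx.integral_comp_le hw hsym hd (by fun_prop) (hmono.monotoneOn univ) le_rfl ht
    (by simp)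
  have h0 : ∫ α in Icc (0:ℝ) 1, φ (truncatedOpinion x 0 α) = 0 := by
    refine setIntegral_eq_zero_of_forall_eq_zero fun α hα => ?_
    obtain ⟨h1, h2⟩ := hx.init_mem α hα
    rw [truncatedOpinion_eq x le_rfl hα]
    simp [hφ, h1, h2]
  have hφ0 (u : ℝ) : 0 ≤ φ u := by positivity
  have hz := (integral_eq_zero_iff_of_nonneg (fun α => hφ0 _)
    (hx.integrable_comp (by fun_prop : Continuous φ) t)).1
    (le_antisymm (h.trans h0.le) (integral_nonneg fun α => hφ0 _))
  filter_upwards [hz] with α hα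
  have h1 : max (truncatedOpinion x t α - 1) 0 ^ 2 + max (-truncatedOpinion x t α) 0 ^ 2 = 0 := hα
  obtain ⟨h2, h3⟩ := (add_eq_zero_iff_of_nonneg (sq_nonneg _) (sq_nonneg _)).1 h1
  simp only [ne_eq, OfNat.ofNat_ne_zero, not_false_eq_true, pow_eq_zero_iff,
    max_eq_right_iff] at h2 h3
  exact ⟨by linarith, by linarith⟩

theorem exists_tendsto_moment (hx : IsSolution w x) (hw : IsWeight W w)
    (hsym : SymmetricWeight w) (n : ℕ) :
    ∃ l, Tendsto (fun t => ∫ α in Icc (0:ℝ) 1, truncatedOpinion x t α ^ n) atTop (𝓝 l) := by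
  have hanti : Antitone fun t => ∫ α in Icc (0:ℝ) 1, truncatedOpinion x t α ^ n := by
    intro s t hst
    dsimp only
    rw [← truncatedOpinion_max_zero x s, ← truncatedOpinion_max_zero x t]
    refine hx.integral_comp_le hw hsym (φ := fun u => u ^ n) (fun u => hasDerivAt_pow n u)
      (by fun_prop) (A := Icc 0 1) (fun a ha b hb hab => ?_) (le_max_right s 0)
      (max_le_max_right 0 hst) fun t ht => hx.ae_mem_Icc hw hsym ht
    have := ha.1
    dsimp only
    gcongr
  refine ⟨_, tendsto_atTop_ciInf hanti ⟨0, ?_⟩⟩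
  rintro _ ⟨t, rfl⟩
  refine integral_nonneg_of_ae ?_
  have := hx.ae_mem_Icc hw hsym (le_max_right t 0)
  rw [truncatedOpinion_max_zero] at this
  filter_upwards [this] with α hα using pow_nonneg hα.1 n

end IsSolution

/-- If the weight function is symmetric and `x` is a solution of the
opinion dynamics, then there is a finite Borel measure `μ∞` supported on `[0,1]` such
that the opinion distributions `μ_t` converge to `μ∞` in distribution as `t → ∞`. -/
theorem opinion_dynamics_converges_in_distribution
    (W : ℝ) (hW : 0 < W) (w : ℝ → ℝ → ℝ → ℝ → ℝ → ℝ) (x : ℝ → ℝ → ℝ)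
    (hw : IsWeight W w) (hsym : SymmetricWeight w) (hx : IsSolution w x) :
    ∃ μlim : Measure ℝ, IsFiniteMeasure μlim ∧ μlim (Icc (0:ℝ) 1)ᶜ = 0 ∧
      ∀ η : BoundedContinuousFunction ℝ ℝ,
        Tendsto (fun t => ∫ y, η y ∂(opinionMeasure x t)) atTop
          (𝓝 (∫ y, η y ∂μlim)) := by
  have hpm (t : ℝ) :
      Measurable fun α => projIcc (0:ℝ) 1 zero_le_one (truncatedOpinion x t α) :=
    continuous_projIcc.measurable.comp (hx.measurable_truncatedOpinion t)
  have : IsProbabilityMeasure (volume.restrict (Icc (0:ℝ) 1)) := ⟨by simp⟩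
  let μ : ℝ → ProbabilityMeasure (Icc (0:ℝ) 1) := fun t =>
    ⟨(volume.restrict (Icc (0:ℝ) 1)).map
      fun α => projIcc (0:ℝ) 1 zero_le_one (truncatedOpinion x t α),
      Measure.isProbabilityMeasure_map (hpm t).aemeasurable⟩
  have hint {η : ℝ → ℝ} (hη : Continuous η) (t : ℝ) :
      ∫ u, η u ∂(μ t : Measure (Icc (0:ℝ) 1)) =
        ∫ α in Icc (0:ℝ) 1, η (truncatedOpinion x t α) := by
    change ∫ u : Icc (0:ℝ) 1, η u ∂((volume.restrict (Icc (0:ℝ) 1)).map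
      fun α => projIcc (0:ℝ) 1 zero_le_one (truncatedOpinion x t α)) = _
    rw [integral_map (hpm t).aemeasurable (by fun_prop)]
    refine integral_congr_ae ?_
    have := hx.ae_mem_Icc hw hsym (le_max_right t 0)
    rw [truncatedOpinion_max_zero] at this
    filter_upwards [this] with α hα
    rw [projIcc_of_mem zero_le_one hα]
  obtain ⟨P, hP⟩ := exists_tendsto_of_tendsto_moments (F := atTop) μ fun n => by
    simp only [hint (continuous_pow n)]
    exact hx.exists_tendsto_moment hw hsym n
  refine ⟨(P : Measure (Icc (0:ℝ) 1)).map Subtype.val, inferInstance, ?_, fun η => ?_⟩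
  · rw [Measure.map_apply measurable_subtype_coe measurableSet_Icc.compl]
    simp
  · have h := ProbabilityMeasure.tendsto_iff_forall_integral_tendsto.1 hP
      (η.compContinuous ⟨Subtype.val, continuous_subtype_val⟩)
    rw [integral_map measurable_subtype_coe.aemeasurable η.continuous.aestronglyMeasurable]
    refine h.congr' ?_
    filter_upwards [eventually_ge_atTop 0] with t ht
    rw [opinionMeasure, integral_map (hx.meas t ht).aemeasurable
      η.continuous.aestronglyMeasurable]
    refine (hint η.continuous t).trans ?_
    refine setIntegral_congr_fun measurableSet_Icc fun α hα => ?_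
    simp only [truncatedOpinion_eq x ht hα]
end

section
/- There exist W > 0, a symmetric weight function w bounded by W, and a solution x of the opinion dynamics with this w, such that the set {α ∈ [0,1] : lim_{t→∞} x_t(α) does not exist} has positive Lebesgue measure. -/
open MeasureTheory Filter Set Topology

/-- The width, in phase, of the interaction band. -/
noncomputable def bandWidth (t : ℝ) : ℝ := (√(1 + |t|))⁻¹

/-- The accumulated damping exponent of the rotating profile. -/
noncomputable def damping (t : ℝ) : ℝ :=
  ∫ s in (0:ℝ)..t, (bandWidth s - Real.sin (bandWidth s)) / (2 * Real.pi)

/-- The accumulated rotation angle of the rotating profile. -/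
noncomputable def rotationAngle (t : ℝ) : ℝ :=
  ∫ s in (0:ℝ)..t, (1 - Real.cos (bandWidth s)) / (2 * Real.pi)

/-- The slowly damped rotating cosine profile. -/
noncomputable def rotatingOpinion (t α : ℝ) : ℝ :=
  1 / 2 + 1 / 2 * Real.exp (-damping t) * Real.cos (2 * Real.pi * α - rotationAngle t)

/-- Agents interact when the sum of their phases lies in a short band above `0` modulo `1`. -/
noncomputable def bandWeight (t α β _a _b : ℝ) : ℝ :=
  if Int.fract (α + β - rotationAngle t / Real.pi) < bandWidth t / (2 * Real.pi) then 1 else 0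

lemma bandWidth_pos (t : ℝ) : 0 < bandWidth t := by
  unfold bandWidth
  positivity

lemma bandWidth_le_one (t : ℝ) : bandWidth t ≤ 1 := by
  unfold bandWidth
  refine inv_le_one_of_one_le₀ ?_
  rw [Real.one_le_sqrt]
  linarith [abs_nonneg t]

lemma continuous_bandWidth : Continuous bandWidth := by
  unfold bandWidth
  refine Continuous.inv₀ (by fun_prop) fun t => ?_
  positivity

lemma hasDerivAt_damping (t : ℝ) :
    HasDerivAt damping ((bandWidth t - Real.sin (bandWidth t)) / (2 * Real.pi)) t := by
  have h := continuous_bandWidth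
  have hc : Continuous fun s => (bandWidth s - Real.sin (bandWidth s)) / (2 * Real.pi) := by
    fun_prop
  exact hc.integral_hasStrictDerivAt 0 t |>.hasDerivAt

lemma hasDerivAt_rotation (t : ℝ) :
    HasDerivAt rotationAngle ((1 - Real.cos (bandWidth t)) / (2 * Real.pi)) t := by
  have h := continuous_bandWidth
  have hc : Continuous fun s => (1 - Real.cos (bandWidth s)) / (2 * Real.pi) := by fun_prop
  exact hc.integral_hasStrictDerivAt 0 t |>.hasDerivAt

lemma continuous_rotation : Continuous rotationAngle :=
  continuous_iff_continuousAt.2 fun t => (hasDerivAt_rotation t).continuousAt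

/-- Integrating against a periodic indicator localises to a short interval. -/
lemma integral_fract_lt_mul {H : ℝ → ℝ} (hH : Function.Periodic H 1) {δ : ℝ}
    (hδ₀ : 0 ≤ δ) (hδ₁ : δ ≤ 1) (d : ℝ) :
    ∫ β in (0:ℝ)..1, (if Int.fract (β + d) < δ then (1:ℝ) else 0) * H (β + d) =
      ∫ u in (0:ℝ)..δ, H u := by
  have hper : Function.Periodic
      (fun u => (if Int.fract u < δ then (1:ℝ) else 0) * H u) 1 := by
    intro u
    simp only [Int.fract_add_one, hH u]
  rw [intervalIntegral.integral_comp_add_right (fun u => (if Int.fract u < δ then (1:ℝ) else 0) * H u) d,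
    zero_add, add_comm 1 d, hper.intervalIntegral_add_eq d 0, zero_add,
    intervalIntegral.integral_of_le zero_le_one, intervalIntegral.integral_of_le hδ₀, integral_Ioc_eq_integral_Ioo,
    integral_Ioc_eq_integral_Ioo]
  have hcongr : ∀ u ∈ Ioo (0:ℝ) 1, (if Int.fract u < δ then (1:ℝ) else 0) * H u =
      (Iio δ).indicator H u := by
    intro u hu
    rw [Int.fract_eq_self.2 ⟨hu.1.le, hu.2⟩]
    by_cases h : u < δ <;> simp [h]
  rw [setIntegral_congr_fun measurableSet_Ioo hcongr, setIntegral_indicator measurableSet_Iio]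
  congr 2
  ext u
  simp only [mem_inter_iff, mem_Ioo, mem_Iio]
  constructor
  · rintro ⟨⟨h1, -⟩, h2⟩
    exact ⟨h1, h2⟩
  · rintro ⟨h1, h2⟩
    exact ⟨⟨h1, h2.trans_le hδ₁⟩, h2⟩

lemma integral_cos_two_pi_mul_sub (δ ψ : ℝ) :
    ∫ u in (0:ℝ)..δ, (Real.cos (2 * Real.pi * u - ψ) - Real.cos ψ) =
      (Real.sin (2 * Real.pi * δ - ψ) + Real.sin ψ) / (2 * Real.pi) - δ * Real.cos ψ := by
  have hderiv : ∀ u ∈ uIcc 0 δ, HasDerivAt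
      (fun u => Real.sin (2 * Real.pi * u - ψ) / (2 * Real.pi) - u * Real.cos ψ)
      (Real.cos (2 * Real.pi * u - ψ) - Real.cos ψ) u := by
    intro u _
    have h1 : HasDerivAt (fun u : ℝ => 2 * Real.pi * u - ψ) (2 * Real.pi) u := by
      simpa using ((hasDerivAt_id u).const_mul (2 * Real.pi)).sub_const ψ
    have h2 := (h1.sin.div_const (2 * Real.pi)).sub
      ((hasDerivAt_id u).mul_const (Real.cos ψ))
    refine h2.congr_deriv ?_
    field_simp
  rw [intervalIntegral.integral_eq_sub_of_hasDerivAt hderiv (Continuous.intervalIntegrable (by fun_prop) _ _)]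
  simp only [mul_zero, zero_sub, Real.sin_neg]
  ring

lemma interactionField_rotatingOpinion (t α : ℝ) :
    interactionField bandWeight rotatingOpinion t α =
      1 / 2 * Real.exp (-damping t) *
        ((1 - Real.cos (bandWidth t)) / (2 * Real.pi) * Real.sin (2 * Real.pi * α - rotationAngle t) -
          (bandWidth t - Real.sin (bandWidth t)) / (2 * Real.pi) *
            Real.cos (2 * Real.pi * α - rotationAngle t)) := by
  set ψ := 2 * Real.pi * α - rotationAngle t with hψ
  set δ := bandWidth t / (2 * Real.pi) with hδ
  set d := α - rotationAngle t / Real.pi with hd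
  have hπ : 2 * Real.pi * δ = bandWidth t := by rw [hδ]; field_simp
  have hδ₀ : 0 ≤ δ := div_nonneg (bandWidth_pos t).le (by positivity)
  have hδ₁ : δ ≤ 1 := by
    rw [hδ, div_le_one (by positivity)]
    linarith [bandWidth_le_one t, Real.pi_gt_three]
  have hper : Function.Periodic
      (fun u => Real.cos (2 * Real.pi * u - ψ) - Real.cos ψ) 1 := by
    intro u
    have : 2 * Real.pi * (u + 1) - ψ = 2 * Real.pi * u - ψ + 2 * Real.pi := by ring
    simp only [this, Real.cos_add_two_pi]
  have key := integral_fract_lt_mul hper hδ₀ hδ₁ d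
  rw [integral_cos_two_pi_mul_sub, hπ] at key
  have hint : ∀ β : ℝ, bandWeight t α β (rotatingOpinion t α) (rotatingOpinion t β) *
      (rotatingOpinion t β - rotatingOpinion t α) = 1 / 2 * Real.exp (-damping t) *
        ((if Int.fract (β + d) < δ then (1:ℝ) else 0) *
          (Real.cos (2 * Real.pi * (β + d) - ψ) - Real.cos ψ)) := by
    intro β
    have h1 : α + β - rotationAngle t / Real.pi = β + d := by rw [hd]; ring
    have h2 : 2 * Real.pi * (β + d) - ψ = 2 * Real.pi * β - rotationAngle t := by
      rw [hd, hψ]; field_simp; ring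
    rw [bandWeight, h1, h2, rotatingOpinion, rotatingOpinion]
    ring
  simp only [interactionField, hint, intervalIntegral.integral_const_mul, key]
  rw [Real.sin_sub, hδ]
  ring

lemma hasDerivAt_rotatingOpinion (t α : ℝ) :
    HasDerivAt (fun s => rotatingOpinion s α)
      (interactionField bandWeight rotatingOpinion t α) t := by
  rw [interactionField_rotatingOpinion]
  have h1 := (hasDerivAt_damping t).neg.exp
  have h2 := ((hasDerivAt_rotation t).const_sub (2 * Real.pi * α)).cos
  have h3 := ((h1.const_mul (1 / 2)).mul h2).const_add (1 / 2)
  refine h3.congr_deriv ?_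
  rw [Pi.neg_apply]
  ring

lemma damping_nonneg {t : ℝ} (ht : 0 ≤ t) : 0 ≤ damping t := by
  refine intervalIntegral.integral_nonneg ht fun s _ => ?_
  have := Real.sin_le (bandWidth_pos s).le
  have := Real.pi_pos
  exact div_nonneg (by linarith) (by positivity)

lemma damping_le_two {t : ℝ} (ht : 0 ≤ t) : damping t ≤ 2 := by
  have hw := continuous_bandWidth
  have hderiv : ∀ s ∈ uIcc 0 t, HasDerivAt (fun s : ℝ => -2 * (√(1 + s))⁻¹)
      (bandWidth s ^ 3) s := by
    intro s hs
    rw [uIcc_of_le ht] at hs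
    have hs0 : 0 < 1 + s := by linarith [hs.1]
    have h1 : HasDerivAt (fun s : ℝ => 1 + s) 1 s := (hasDerivAt_id s).const_add 1
    have h2 := ((h1.sqrt hs0.ne').inv (Real.sqrt_pos.2 hs0).ne').const_mul (-2)
    refine h2.congr_deriv ?_
    rw [bandWidth, abs_of_nonneg hs.1]
    have : √(1 + s) ≠ 0 := (Real.sqrt_pos.2 hs0).ne'
    field_simp
  have hint := intervalIntegral.integral_eq_sub_of_hasDerivAt hderiv
    (Continuous.intervalIntegrable (by fun_prop) _ _)
  have hle : damping t ≤ ∫ s in (0:ℝ)..t, bandWidth s ^ 3 := by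
    refine intervalIntegral.integral_mono_on ht (Continuous.intervalIntegrable (by fun_prop) _ _)
      (Continuous.intervalIntegrable (by fun_prop) _ _) fun s _ => ?_
    have h1 := Real.sin_gt_sub_cube (bandWidth_pos s)
    have h2 := pow_pos (bandWidth_pos s) 3
    rw [div_le_iff₀ (by positivity)]
    nlinarith [Real.pi_gt_three]
  have : 0 ≤ (√(1 + t))⁻¹ := by positivity
  rw [hint] at hle
  norm_num at hle
  linarith

lemma tendsto_rotation : Tendsto rotationAngle atTop atTop := by
  have hw := continuous_bandWidth
  set k : ℝ := 1 / Real.pi ^ 3 with hk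
  have hkpos : 0 < k := by positivity
  have hbound : ∀ t, 0 ≤ t → k * Real.log (1 + t) ≤ rotationAngle t := by
    intro t ht
    have hderiv : ∀ s ∈ uIcc 0 t, HasDerivAt (fun s : ℝ => k * Real.log (1 + s))
        (k * bandWidth s ^ 2) s := by
      intro s hs
      rw [uIcc_of_le ht] at hs
      have hs0 : 0 < 1 + s := by linarith [hs.1]
      have h1 : HasDerivAt (fun s : ℝ => 1 + s) 1 s := (hasDerivAt_id s).const_add 1
      refine ((h1.log hs0.ne').const_mul k).congr_deriv ?_
      rw [bandWidth, abs_of_nonneg hs.1, inv_pow, Real.sq_sqrt hs0.le, one_div]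
    have hint := intervalIntegral.integral_eq_sub_of_hasDerivAt hderiv
      (Continuous.intervalIntegrable (by fun_prop) _ _)
    have hle : ∫ s in (0:ℝ)..t, k * bandWidth s ^ 2 ≤ rotationAngle t := by
      refine intervalIntegral.integral_mono_on ht (Continuous.intervalIntegrable (by fun_prop) _ _)
        (Continuous.intervalIntegrable (by fun_prop) _ _) fun s _ => ?_
      have h0 := bandWidth_pos s
      have h1 : 2 / Real.pi * (bandWidth s / 2) ≤ Real.sin (bandWidth s / 2) :=
        Real.mul_le_sin (by linarith) (by linarith [bandWidth_le_one s, Real.pi_gt_three])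
      have h2 : 1 - Real.cos (bandWidth s) = 2 * Real.sin (bandWidth s / 2) ^ 2 := by
        have := Real.sin_sq_eq_half_sub (bandWidth s / 2)
        rw [mul_div_cancel₀ _ two_ne_zero] at this
        linarith
      have h3 := pow_le_pow_left₀ (by positivity) h1 2
      rw [h2, le_div_iff₀ (by positivity)]
      refine le_trans (le_of_eq ?_) (mul_le_mul_of_nonneg_left h3 zero_le_two)
      rw [hk]
      field_simp
    rw [hint] at hle
    simpa using hle
  refine tendsto_atTop_mono' atTop ((eventually_ge_atTop 0).mono hbound) ?_
  exact (Real.tendsto_log_atTop.comp (tendsto_atTop_add_const_left _ 1 tendsto_id)).const_mul_atTop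
    hkpos

/-- A continuous function tending to infinity attains any given angle, modulo `2π`, at
arbitrarily late times. -/
lemma frequently_eq_add_int_mul_two_pi {φ : ℝ → ℝ} (hc : Continuous φ)
    (hφ : Tendsto φ atTop atTop) (c : ℝ) :
    ∃ᶠ t in atTop, ∃ n : ℕ, φ t = c + n * (2 * Real.pi) := by
  rw [frequently_atTop]
  intro T
  obtain ⟨n, hn⟩ := exists_nat_ge ((φ T - c) / (2 * Real.pi))
  rw [div_le_iff₀ (by positivity)] at hn
  obtain ⟨T', hT', hle⟩ :=
    ((hφ.eventually_ge_atTop (c + n * (2 * Real.pi))).and (eventually_ge_atTop T)).exists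
  obtain ⟨t, ht, hte⟩ := intermediate_value_Icc hle hc.continuousOn
    ⟨by linarith, hT'⟩
  exact ⟨t, ht.1, n, hte⟩

lemma not_tendsto_rotatingOpinion (α : ℝ) :
    ¬ ∃ l : ℝ, Tendsto (fun t => rotatingOpinion t α) atTop (𝓝 l) := by
  rintro ⟨l, hl⟩
  have hamp : ∀ t, 0 ≤ t → Real.exp (-2) ≤ Real.exp (-damping t) := fun t ht =>
    Real.exp_le_exp.2 (neg_le_neg (damping_le_two ht))
  have hfreq := frequently_eq_add_int_mul_two_pi continuous_rotation tendsto_rotation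
  have hhigh : ∃ᶠ t in atTop, 1 / 2 + 1 / 2 * Real.exp (-2) ≤ rotatingOpinion t α := by
    refine ((hfreq (2 * Real.pi * α)).and_eventually (eventually_ge_atTop 0)).mono ?_
    rintro t ⟨⟨n, hn⟩, ht⟩
    have : 2 * Real.pi * α - rotationAngle t = 0 - n * (2 * Real.pi) := by rw [hn]; ring
    rw [rotatingOpinion, this, Real.cos_sub_nat_mul_two_pi, Real.cos_zero]
    linarith [hamp t ht]
  have hlow : ∃ᶠ t in atTop, rotatingOpinion t α ≤ 1 / 2 - 1 / 2 * Real.exp (-2) := by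
    refine ((hfreq (2 * Real.pi * α - Real.pi)).and_eventually (eventually_ge_atTop 0)).mono ?_
    rintro t ⟨⟨n, hn⟩, ht⟩
    have : 2 * Real.pi * α - rotationAngle t = Real.pi - n * (2 * Real.pi) := by rw [hn]; ring
    rw [rotatingOpinion, this, Real.cos_sub_nat_mul_two_pi, Real.cos_pi]
    linarith [hamp t ht]
  have h1 := ge_of_tendsto_of_frequently hl hhigh
  have h2 := le_of_tendsto_of_frequently hl hlow
  linarith [Real.exp_pos (-2)]

lemma abs_rotatingOpinion_sub_half_le {t : ℝ} (ht : 0 ≤ t) (α : ℝ) :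
    |rotatingOpinion t α - 1 / 2| ≤ 1 / 2 := by
  have h1 : Real.exp (-damping t) ≤ 1 := Real.exp_le_one_iff.2 (by linarith [damping_nonneg ht])
  have h2 := Real.abs_cos_le_one (2 * Real.pi * α - rotationAngle t)
  rw [rotatingOpinion, add_sub_cancel_left, abs_mul, abs_mul, abs_of_pos (Real.exp_pos _),
    abs_of_pos (by norm_num : (0:ℝ) < 1 / 2)]
  have := mul_le_mul h1 h2 (abs_nonneg _) zero_le_one
  linarith

lemma bandWeight_nonneg (t α β a b : ℝ) : 0 ≤ bandWeight t α β a b := by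
  unfold bandWeight
  split_ifs <;> norm_num

lemma bandWeight_le_one (t α β a b : ℝ) : bandWeight t α β a b ≤ 1 := by
  unfold bandWeight
  split_ifs <;> norm_num

lemma isWeight_bandWeight : IsWeight 1 bandWeight where
  measurable := by
    unfold bandWeight
    have h1 := continuous_rotation.measurable
    have h2 := continuous_bandWidth.measurable
    refine Measurable.ite (measurableSet_lt ?_ ?_) measurable_const measurable_const
    · exact Measurable.fract (by fun_prop)
    · fun_prop
  nonneg t _ α _ β _ a b := bandWeight_nonneg t α β a b
  le_bound t _ α _ β _ a b := bandWeight_le_one t α β a b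

lemma symmetricWeight_bandWeight : SymmetricWeight bandWeight := by
  intro t α β a b
  rw [bandWeight, bandWeight, add_comm α β]

lemma abs_interactionField_rotatingOpinion_le {t : ℝ} (ht : 0 ≤ t) (α : ℝ) :
    |interactionField bandWeight rotatingOpinion t α| ≤ 1 := by
  have h : ∀ β ∈ uIoc (0:ℝ) 1, ‖bandWeight t α β (rotatingOpinion t α) (rotatingOpinion t β) *
      (rotatingOpinion t β - rotatingOpinion t α)‖ ≤ 1 := by
    intro β _
    rw [Real.norm_eq_abs, abs_mul, abs_of_nonneg (bandWeight_nonneg ..)]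
    refine mul_le_one₀ (bandWeight_le_one ..) (abs_nonneg _) ?_
    have h1 := abs_le.1 (abs_rotatingOpinion_sub_half_le ht α)
    have h2 := abs_le.1 (abs_rotatingOpinion_sub_half_le ht β)
    exact abs_le.2 ⟨by linarith, by linarith⟩
  simpa [interactionField] using intervalIntegral.norm_integral_le_of_norm_le_const h

/-- A function that is `1`-Lipschitz on an interval is absolutely continuous there. -/
lemma absolutelyContinuousOn_of_abs_sub_le {f : ℝ → ℝ} {a b : ℝ}
    (hf : ∀ c d, a ≤ c → c ≤ d → d ≤ b → |f d - f c| ≤ d - c) :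
    AbsolutelyContinuousOn f a b := by
  intro ε hε
  refine ⟨ε, hε, fun n c d hcd _ hsum => lt_of_le_of_lt ?_ hsum⟩
  exact Finset.sum_le_sum fun i _ => hf _ _ (hcd i).1 (hcd i).2.1 (hcd i).2.2

lemma isSolution_rotatingOpinion : IsSolution bandWeight rotatingOpinion where
  meas t _ := by
    unfold rotatingOpinion
    fun_prop
  absCont α _ T _ := by
    refine absolutelyContinuousOn_of_abs_sub_le fun c d hc hcd _ => ?_
    have := (convex_Icc c d).norm_image_sub_le_of_norm_hasDerivWithin_le
      (fun t _ => (hasDerivAt_rotatingOpinion t α).hasDerivWithinAt)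
      (fun t ht => abs_interactionField_rotatingOpinion_le (hc.trans ht.1) α)
      (left_mem_Icc.2 hcd) (right_mem_Icc.2 hcd)
    simpa [Real.norm_eq_abs, abs_of_nonneg (sub_nonneg.2 hcd)] using this
  init_mem α _ := by
    have := abs_le.1 (abs_rotatingOpinion_sub_half_le le_rfl α)
    exact ⟨by linarith, by linarith⟩
  locBdd T _ := by
    refine ⟨1, fun α _ t ht => ?_⟩
    have := abs_le.1 (abs_rotatingOpinion_sub_half_le ht.1 α)
    exact abs_le.2 ⟨by linarith, by linarith⟩
  ode α _ := ae_of_all _ fun t => hasDerivAt_rotatingOpinion t α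


/-- There exist `W > 0`, a symmetric weight function bounded by `W`,
and a solution of the opinion dynamics for which the set of agents whose opinion does
not converge has positive Lebesgue measure. -/
theorem exists_symmetric_solution_with_nonconvergent_agents :
    ∃ (W : ℝ) (w : ℝ → ℝ → ℝ → ℝ → ℝ → ℝ) (x : ℝ → ℝ → ℝ),
      0 < W ∧ IsWeight W w ∧ SymmetricWeight w ∧ IsSolution w x ∧
      0 < volume {α ∈ Icc (0:ℝ) 1 |
        ¬ ∃ l : ℝ, Tendsto (fun t => x t α) atTop (𝓝 l)} := by
  refine ⟨1, bandWeight, rotatingOpinion, one_pos, isWeight_bandWeight,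
    symmetricWeight_bandWeight, isSolution_rotatingOpinion, ?_⟩
  have hset : {α ∈ Icc (0:ℝ) 1 |
      ¬ ∃ l : ℝ, Tendsto (fun t => rotatingOpinion t α) atTop (𝓝 l)} = Icc 0 1 :=
    sep_eq_self_iff_mem_true.2 fun α _ => not_tendsto_rotatingOpinion α
  rw [hset, Real.volume_Icc]
  simp
end

section
/- Suppose the weight function w is symmetric and x is a solution of the opinion dynamics. Let f : ℝ → ℝ be convex and differentiable everywhere. Then the function V_f : [0,∞) → ℝ defined by V_f(t) = ∫_0^1 f(x_t(α)) dα is nonincreasing in t. -/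
open MeasureTheory Filter Set Topology

/-- On `[a, b]`, the `Fin`-indexed definition of absolute continuity implies Mathlib's. -/
lemma AbsolutelyContinuousOn.absolutelyContinuousOnInterval_s5 {u : ℝ → ℝ} {a b : ℝ} (hab : a ≤ b)
    (hu : AbsolutelyContinuousOn u a b) : AbsolutelyContinuousOnInterval u a b := by
  rw [absolutelyContinuousOnInterval_iff]
  intro ε hε
  obtain ⟨δ, hδ, h⟩ := hu ε hε
  refine ⟨δ, hδ, fun E hE hlen => ?_⟩
  obtain ⟨n, I⟩ := E
  obtain ⟨hmem, hdisj⟩ := hE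
  simp only [Finset.mem_range, uIcc_of_le hab] at hmem
  have key := h n (fun i => min (I i).1 (I i).2) (fun i => max (I i).1 (I i).2) ?_ ?_ ?_
  · rw [Finset.sum_range]
    refine lt_of_le_of_lt (le_of_eq (Finset.sum_congr rfl fun i _ => ?_)) key
    rcases le_total (I i).1 (I i).2 with hi | hi
    · simp [hi, Real.dist_eq, abs_sub_comm]
    · simp [hi, Real.dist_eq]
  · intro i
    obtain ⟨h₁, h₂⟩ := hmem i i.2
    exact ⟨le_min h₁.1 h₂.1, min_le_max, max_le h₁.2 h₂.2⟩
  · intro i j hij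
    have hd := hdisj (Finset.mem_coe.2 (Finset.mem_range.2 i.2))
      (Finset.mem_coe.2 (Finset.mem_range.2 j.2)) (fun hc => hij (Fin.ext hc))
    exact disjoint_iff_inter_eq_empty.1 (hd.mono Ioo_subset_Ioc_self Ioo_subset_Ioc_self)
  · rw [Finset.sum_range] at hlen
    refine lt_of_le_of_lt (le_of_eq (Finset.sum_congr rfl fun i _ => ?_)) hlen
    rw [max_sub_min_eq_abs', Real.dist_eq]

/-- Postcomposing an absolutely continuous function with a function which is Lipschitz on a set
containing its values gives an absolutely continuous function. -/
lemma LipschitzOnWith.comp_absolutelyContinuousOnInterval {f u : ℝ → ℝ} {a b : ℝ} {K : NNReal}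
    {S : Set ℝ} (hf : LipschitzOnWith K f S) (hu : AbsolutelyContinuousOnInterval u a b)
    (hS : MapsTo u (uIcc a b) S) : AbsolutelyContinuousOnInterval (fun t => f (u t)) a b := by
  rw [absolutelyContinuousOnInterval_iff] at hu ⊢
  intro ε hε
  obtain ⟨δ, hδ, h⟩ := hu (ε / (K + 1)) (by positivity)
  refine ⟨δ, hδ, fun E hE hlen => ?_⟩
  calc ∑ i ∈ Finset.range E.1, dist (f (u (E.2 i).1)) (f (u (E.2 i).2))
      ≤ ∑ i ∈ Finset.range E.1, (K + 1) * dist (u (E.2 i).1) (u (E.2 i).2) := by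
        refine Finset.sum_le_sum fun i hi => ?_
        refine (hf.dist_le_mul _ (hS (hE.1 i hi).1) _ (hS (hE.1 i hi).2)).trans ?_
        gcongr
        simp
    _ = (K + 1) * ∑ i ∈ Finset.range E.1, dist (u (E.2 i).1) (u (E.2 i).2) := by
        rw [Finset.mul_sum]
    _ < (K + 1) * (ε / (K + 1)) := by
        have := h E hE hlen
        gcongr
    _ = ε := by field_simp

/-- A symmetric nonnegative averaging kernel pairs nonpositively with a monotone function of the
averaged quantity. -/
lemma integral_integral_monotone_mul_symm_kernel_nonpos {Ω : Type*} [MeasurableSpace Ω]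
    {μ : Measure Ω} [SFinite μ] {g : ℝ → ℝ} (hg : Monotone g) {u : Ω → ℝ} {k : Ω → Ω → ℝ}
    (hk : ∀ a b, 0 ≤ k a b) (hsymm : ∀ a b, k a b = k b a)
    (hInt : Integrable (fun p : Ω × Ω => g (u p.1) * (k p.1 p.2 * (u p.2 - u p.1))) (μ.prod μ)) :
    ∫ a, ∫ b, g (u a) * (k a b * (u b - u a)) ∂μ ∂μ ≤ 0 := by
  rw [integral_integral (f := fun a b => g (u a) * (k a b * (u b - u a))) hInt]
  have hswap := integral_prod_swap (μ := μ) (ν := μ)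
    (fun p : Ω × Ω => g (u p.1) * (k p.1 p.2 * (u p.2 - u p.1)))
  have hadd := integral_add hInt hInt.swap
  have hle : ∫ p, ((fun p : Ω × Ω => g (u p.1) * (k p.1 p.2 * (u p.2 - u p.1))) p +
      ((fun p : Ω × Ω => g (u p.1) * (k p.1 p.2 * (u p.2 - u p.1))) ∘ Prod.swap) p)
      ∂(μ.prod μ) ≤ 0 := by
    refine integral_nonpos fun p => ?_
    simp only [Function.comp, Prod.fst_swap, Prod.snd_swap, Pi.zero_apply]
    rw [hsymm p.2 p.1]
    have hprod : 0 ≤ (g (u p.1) - g (u p.2)) * (u p.1 - u p.2) := by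
      rcases le_total (u p.1) (u p.2) with h | h
      · exact mul_nonneg_of_nonpos_of_nonpos (sub_nonpos.2 (hg h)) (sub_nonpos.2 h)
      · exact mul_nonneg (sub_nonneg.2 (hg h)) (sub_nonneg.2 h)
    nlinarith [mul_nonneg (hk p.1 p.2) hprod]
  simp only [Function.comp_apply] at hadd hle
  linarith

/-- The chain rule and the fundamental theorem of calculus along the trajectory of one agent. -/
lemma IsSolution.integral_deriv_mul_interactionField {w : ℝ → ℝ → ℝ → ℝ → ℝ → ℝ} {x : ℝ → ℝ → ℝ}
    (hx : IsSolution w x) {f : ℝ → ℝ} (hdiff : Differentiable ℝ f) {K : NNReal} {M s t α : ℝ}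
    (hf : LipschitzOnWith K f (Icc (-M) M)) (hs : 0 ≤ s) (hst : s ≤ t) (hα : α ∈ Icc (0:ℝ) 1)
    (hM : ∀ τ ∈ Icc 0 t, |x τ α| ≤ M) :
    ∫ τ in s..t, deriv f (x τ α) * interactionField w x τ α = f (x t α) - f (x s α) := by
  have hac : AbsolutelyContinuousOnInterval (fun τ => f (x τ α)) s t := by
    refine hf.comp_absolutelyContinuousOnInterval (u := fun τ => x τ α)
      (((hx.absCont α hα t (hs.trans hst)).absolutelyContinuousOnInterval_s5 (hs.trans hst)).mono ?_)
      fun τ hτ => ?_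
    · rw [uIcc_of_le hst, uIcc_of_le (hs.trans hst)]
      exact Icc_subset_Icc_left hs
    · rw [uIcc_of_le hst] at hτ
      exact abs_le.1 (hM τ ⟨hs.trans hτ.1, hτ.2⟩)
  rw [← hac.integral_deriv_eq_sub]
  refine intervalIntegral.integral_congr_ae ?_
  filter_upwards [(ae_restrict_iff' measurableSet_Ici).1 (hx.ode α hα)] with τ hτ hmem
  rw [uIoc_of_le hst] at hmem
  exact ((hdiff (x τ α)).hasDerivAt.comp τ (hτ (hs.trans hmem.1.le))).deriv.symm

/-- For a symmetric weight function and any solution of the opinion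
dynamics, every convex differentiable `f : ℝ → ℝ` gives a Lyapunov function
`V_f(t) = ∫_0^1 f(x_t(α)) dα`, which is nonincreasing on `[0,∞)`. -/
theorem convex_lyapunov_function_nonincreasing
    (W : ℝ) (hW : 0 < W) (w : ℝ → ℝ → ℝ → ℝ → ℝ → ℝ) (x : ℝ → ℝ → ℝ)
    (hw : IsWeight W w) (hsym : SymmetricWeight w) (hx : IsSolution w x)
    (f : ℝ → ℝ) (hconv : ConvexOn ℝ Set.univ f) (hdiff : Differentiable ℝ f) :
    AntitoneOn (fun t => ∫ α in (0:ℝ)..1, f (x t α)) (Ici (0:ℝ)) := by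
  intro s hs t ht hst
  have hs : 0 ≤ s := hs
  have ht : 0 ≤ t := ht
  obtain ⟨M, hM⟩ := hx.locBdd t ht
  have hmono : Monotone (deriv f) :=
    monotoneOn_univ.1 (hconv.monotoneOn_deriv fun y _ => hdiff y)
  obtain ⟨C, hC⟩ : ∃ C : NNReal, ∀ y ∈ Icc (-M) M, ‖deriv f y‖₊ ≤ C := by
    refine ⟨⟨max |deriv f (-M)| |deriv f M|, by positivity⟩, fun y hy => ?_⟩
    exact NNReal.coe_le_coe.1 (abs_le_max_abs_abs (hmono hy.1) (hmono hy.2))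
  have hlip : LipschitzOnWith C f (Icc (-M) M) :=
    (convex_Icc _ _).lipschitzOnWith_of_nnnorm_deriv_le (fun y _ => hdiff y) hC
  -- Clamping both arguments extends the trajectories to globally bounded measurable functions.
  let T : ℝ → ℝ := fun τ => projIcc 0 t ht τ
  let A : ℝ → ℝ := fun α => projIcc (0:ℝ) 1 zero_le_one α
  have hTcont : Continuous T := continuous_subtype_val.comp continuous_projIcc
  have hAcont : Continuous A := continuous_subtype_val.comp continuous_projIcc
  have hTmem : ∀ τ, T τ ∈ Icc 0 t := fun τ => (projIcc 0 t ht τ).2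
  have hAmem : ∀ α, A α ∈ Icc (0:ℝ) 1 := fun α => (projIcc (0:ℝ) 1 zero_le_one α).2
  have hTeq : ∀ τ ∈ Icc 0 t, T τ = τ := fun τ hτ => by simp [T, projIcc_of_mem ht hτ]
  have hAeq : ∀ α ∈ Icc (0:ℝ) 1, A α = α := fun α hα => by
    simp [A, projIcc_of_mem zero_le_one hα]
  let y : ℝ → ℝ → ℝ := fun τ α => x (T τ) (A α)
  have hyM : ∀ τ α, |y τ α| ≤ M := fun τ α => hM _ (hAmem α) _ (hTmem τ)
  have hymeas : Measurable (Function.uncurry y) := by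
    refine measurable_uncurry_of_continuous_of_measurable (fun α => ?_) fun τ =>
      (hx.meas _ (hTmem τ).1).comp hAcont.measurable
    have hcont :=
      ((hx.absCont _ (hAmem α) t ht).absolutelyContinuousOnInterval_s5 ht).continuousOn
    rw [uIcc_of_le ht] at hcont
    exact hcont.comp_continuous hTcont hTmem
  let k : ℝ → ℝ → ℝ → ℝ := fun τ α β => w (T τ) (A α) (A β) (y τ α) (y τ β)
  let F : ℝ → ℝ → ℝ → ℝ := fun τ α β => deriv f (y τ α) * (k τ α β * (y τ β - y τ α))
  have hFmeas : Measurable fun p : ℝ × ℝ × ℝ => F p.1 p.2.1 p.2.2 := by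
    have h₁ : Measurable fun p : ℝ × ℝ × ℝ => y p.1 p.2.1 :=
      hymeas.comp (measurable_fst.prodMk measurable_snd.fst)
    have h₂ : Measurable fun p : ℝ × ℝ × ℝ => y p.1 p.2.2 :=
      hymeas.comp (measurable_fst.prodMk measurable_snd.snd)
    have h₃ : Measurable fun p : ℝ × ℝ × ℝ => k p.1 p.2.1 p.2.2 :=
      hw.measurable.comp ((hTcont.measurable.comp measurable_fst).prodMk
        ((hAcont.measurable.comp measurable_snd.fst).prodMk
          ((hAcont.measurable.comp measurable_snd.snd).prodMk (h₁.prodMk h₂))))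
    exact ((measurable_deriv f).comp h₁).mul (h₃.mul (h₂.sub h₁))
  have hFbound : ∀ τ α β, ‖F τ α β‖ ≤ C * (W * (M + M)) := fun τ α β => by
    have hk₀ : 0 ≤ k τ α β := hw.nonneg _ (hTmem τ).1 _ (hAmem α) _ (hAmem β) _ _
    have hk₁ : k τ α β ≤ W := hw.le_bound _ (hTmem τ).1 _ (hAmem α) _ (hAmem β) _ _
    simp only [F, norm_mul]
    gcongr
    · exact NNReal.coe_le_coe.2 (hC _ (abs_le.1 (hyM τ α)))
    · rwa [Real.norm_of_nonneg hk₀]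
    · exact (norm_sub_le _ _).trans (add_le_add (hyM τ β) (hyM τ α))
  let μ : Measure ℝ := volume.restrict (Ioc 0 1)
  have hfint : ∀ τ ∈ Icc 0 t, Integrable (fun α => f (x τ α)) μ := fun τ hτ => by
    obtain ⟨B, hB⟩ := (isCompact_Icc (a := -M) (b := M)).exists_bound_of_continuousOn
      hdiff.continuous.continuousOn
    refine Integrable.of_bound
      (hdiff.continuous.measurable.comp (hx.meas τ hτ.1)).aestronglyMeasurable B ?_
    filter_upwards [ae_restrict_mem measurableSet_Ioc] with α hα
    exact hB _ (abs_le.1 (hM α (Ioc_subset_Icc_self hα) τ hτ))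
  have hdiffV : ∫ α, (f (x t α) - f (x s α)) ∂μ = ∫ α, (∫ τ in s..t, ∫ β, F τ α β ∂μ) ∂μ := by
    refine integral_congr_ae ?_
    filter_upwards [ae_restrict_mem measurableSet_Ioc] with α hα
    have hα := Ioc_subset_Icc_self hα
    rw [← hx.integral_deriv_mul_interactionField hdiff hlip hs hst hα (hM α hα)]
    refine intervalIntegral.integral_congr fun τ hτ => ?_
    rw [uIcc_of_le hst] at hτ
    have hτ : τ ∈ Icc 0 t := ⟨hs.trans hτ.1, hτ.2⟩
    simp only [F, interactionField, integral_const_mul, y, hTeq τ hτ, hAeq α hα]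
    rw [intervalIntegral.integral_of_le zero_le_one]
    congr 1
    refine setIntegral_congr_fun measurableSet_Ioc fun β hβ => ?_
    simp only [k, y, hTeq τ hτ, hAeq α hα, hAeq β (Ioc_subset_Icc_self hβ)]
  have hswap : ∫ τ in s..t, ∫ α, ∫ β, F τ α β ∂μ ∂μ
      = ∫ α, (∫ τ in s..t, ∫ β, F τ α β ∂μ) ∂μ := by
    refine intervalIntegral_integral_swap (f := fun τ α => ∫ β, F τ α β ∂μ) ?_
    have hassoc : Measurable fun q : (ℝ × ℝ) × ℝ => F q.1.1 q.1.2 q.2 :=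
      hFmeas.comp (measurable_fst.fst.prodMk (measurable_fst.snd.prodMk measurable_snd))
    have : IsFiniteMeasure (volume.restrict (uIoc s t)) := by
      rw [uIoc_of_le hst]
      infer_instance
    refine Integrable.of_bound
      (hassoc.stronglyMeasurable.integral_prod_right' (ν := μ)).aestronglyMeasurable
      (C * (W * (M + M)) * μ.real univ) (Eventually.of_forall fun p => ?_)
    exact norm_integral_le_of_norm_le_const (Eventually.of_forall fun β => hFbound p.1 p.2 β)
  have hnonpos : ∫ τ in s..t, ∫ α, ∫ β, F τ α β ∂μ ∂μ ≤ 0 := by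
    rw [intervalIntegral.integral_of_le hst]
    refine integral_nonpos fun τ => ?_
    refine integral_integral_monotone_mul_symm_kernel_nonpos hmono (u := y τ) (k := k τ)
      (fun α β => hw.nonneg _ (hTmem τ).1 _ (hAmem α) _ (hAmem β) _ _)
      (fun α β => hsym _ _ _ _ _) ?_
    exact Integrable.of_bound
      (hFmeas.comp (measurable_const.prodMk measurable_id)).aestronglyMeasurable _
      (Eventually.of_forall fun p => hFbound τ p.1 p.2)
  rw [← hswap, integral_sub (hfint t ⟨ht, le_rfl⟩) (hfint s ⟨hs, hst⟩)] at hdiffV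
  simp only [intervalIntegral.integral_of_le (zero_le_one (α := ℝ))]
  exact sub_nonpos.1 (hdiffV.trans_le hnonpos)
end
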